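/- Exponential transformation of the Schrödinger equation (converse direction, core of the paper's Theorem 3 on wave function collapse): Let ħ > 0, m > 0, let V : ℝⁿ → ℝ be continuous, and let ψ and ψ̃ be nowhere vanishing ℂ-valued functions on ℝⁿ × ℝ, twice continuously differentiable in x and once in t, both satisfying the Schrödinger equation ∂ψ/∂t = (iħ/(2m))Δψ − (i/ħ)V(x)ψ and ∂ψ̃/∂t = (iħ/(2m))Δψ̃ − (i/ħ)V(x)ψ̃ at every (x,t). Define the quantum drift field v_q := (ħ/(i·m))·(∇ψ/ψ), and let φ : ℝⁿ × ℝ → ℂ be twice continuously differentiable in x and once in t with exp(φ(x,t)) = ψ̃(x,t)/ψ(x,t) for all (x,t). Then φ satisfies the Hamilton–Jacobi-type equation ∂φ/∂t + v_q·∇φ − (iħ/(2m))Δφ = (iħ/(2m))·∇φ·∇φ at every (x,t). -/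

import Mathlib

open Complex

/-- Spatial partial derivative in direction `i` of a `ℂ`-valued function `f(x,t)`. -/
noncomputable def pd {n : ℕ} (i : Fin n) (f : (Fin n → ℝ) → ℝ → ℂ) :
    (Fin n → ℝ) → ℝ → ℂ :=
  fun x t => fderiv ℝ (fun y => f y t) x (Pi.single i 1)

section SpatialDerivative

variable {n : ℕ} {f g : (Fin n → ℝ) → ℝ → ℂ} {x : Fin n → ℝ} {t : ℝ}

theorem pd_add (i : Fin n) (hf : DifferentiableAt ℝ (fun y => f y t) x)
    (hg : DifferentiableAt ℝ (fun y => g y t) x) :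
    pd i (fun y s => f y s + g y s) x t = pd i f x t + pd i g x t := by
  simp only [pd]
  rw [(hf.hasFDerivAt.fun_add hg.hasFDerivAt).fderiv]
  simp

theorem pd_mul (i : Fin n) (hf : DifferentiableAt ℝ (fun y => f y t) x)
    (hg : DifferentiableAt ℝ (fun y => g y t) x) :
    pd i (fun y s => f y s * g y s) x t = pd i f x t * g x t + f x t * pd i g x t := by
  simp only [pd]
  rw [(hf.hasFDerivAt.fun_mul hg.hasFDerivAt).fderiv]
  simp only [add_apply, smul_apply, smul_eq_mul]
  ring

theorem pd_cexp (i : Fin n) (hg : DifferentiableAt ℝ (fun y => g y t) x) :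
    pd i (fun y s => exp (g y s)) x t = exp (g x t) * pd i g x t := by
  simp only [pd]
  rw [hg.hasFDerivAt.cexp.fderiv]
  simp

theorem pd_mul_cexp (i : Fin n) (hf : DifferentiableAt ℝ (fun y => f y t) x)
    (hg : DifferentiableAt ℝ (fun y => g y t) x) :
    pd i (fun y s => f y s * exp (g y s)) x t
      = (pd i f x t + f x t * pd i g x t) * exp (g x t) := by
  rw [pd_mul i hf hg.cexp, pd_cexp i hg]
  ring

theorem differentiable_pd (i : Fin n) (hf : ContDiff ℝ 2 (fun y => f y t)) :
    Differentiable ℝ (fun y => pd i f y t) := by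
  have h : ContDiff ℝ 1 (fderiv ℝ (fun y => f y t)) := hf.fderiv_right (by norm_num)
  exact (h.differentiable one_ne_zero).clm_apply (differentiable_const _)

theorem pd_pd_mul_cexp (i : Fin n) (hf : ∀ t, ContDiff ℝ 2 (fun y => f y t))
    (hg : ∀ t, ContDiff ℝ 2 (fun y => g y t)) :
    pd i (pd i (fun y s => f y s * exp (g y s))) x t
      = (pd i (pd i f) x t + 2 * (pd i f x t * pd i g x t)
          + f x t * (pd i (pd i g) x t + pd i g x t ^ 2)) * exp (g x t) := by
  have hf' : ∀ t, Differentiable ℝ (fun y => f y t) := fun t =>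
    (hf t).differentiable two_ne_zero
  have hg' : ∀ t, Differentiable ℝ (fun y => g y t) := fun t =>
    (hg t).differentiable two_ne_zero
  have hfirst : pd i (fun y s => f y s * exp (g y s))
      = fun y s => (pd i f y s + f y s * pd i g y s) * exp (g y s) := by
    funext y s
    exact pd_mul_cexp i (hf' s y) (hg' s y)
  have hpf := differentiable_pd i (hf t) x
  have hpg := differentiable_pd i (hg t) x
  have hfpg : DifferentiableAt ℝ (fun y => f y t * pd i g y t) x := (hf' t x).mul hpg
  rw [hfirst, pd_mul_cexp (f := fun y s => pd i f y s + f y s * pd i g y s) i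
    (hpf.add hfpg) (hg' t x), pd_add (g := fun y s => f y s * pd i g y s) i hpf hfpg,
    pd_mul i (hf' t x) hpg]
  ring

end SpatialDerivative

/-- Exponential transformation of the Schrödinger equation (converse direction, core of
the wave function collapse theorem): if the nowhere-vanishing `ψ` and `ψ̃` both satisfy
the Schrödinger equation, `v_q = (ħ/(im))∇ψ/ψ` is the quantum drift field, and
`exp(φ) = ψ̃/ψ`, then `φ` satisfies
`∂φ/∂t + v_q·∇φ − (iħ/(2m))Δφ = (iħ/(2m))∇φ·∇φ`. -/
theorem schrodinger_exp_transform_converse {n : ℕ} (hbar m : ℝ)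
    (hhbar : 0 < hbar) (hm : 0 < m)
    (V : (Fin n → ℝ) → ℝ) (hV : Continuous V)
    (ψ ψt : (Fin n → ℝ) → ℝ → ℂ)
    (hψ0 : ∀ x t, ψ x t ≠ 0) (hψt0 : ∀ x t, ψt x t ≠ 0)
    (hψx : ∀ t, ContDiff ℝ 2 (fun x => ψ x t))
    (hψtime : ∀ x, ContDiff ℝ 1 (fun t => ψ x t))
    (hψtx : ∀ t, ContDiff ℝ 2 (fun x => ψt x t))
    (hψttime : ∀ x, ContDiff ℝ 1 (fun t => ψt x t))
    (hSE : ∀ x t, deriv (fun s => ψ x s) t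
        = (I * (hbar : ℂ) / (2 * (m : ℂ))) * ∑ i, pd i (pd i ψ) x t
          - (I / (hbar : ℂ)) * (V x : ℂ) * ψ x t)
    (hSEt : ∀ x t, deriv (fun s => ψt x s) t
        = (I * (hbar : ℂ) / (2 * (m : ℂ))) * ∑ i, pd i (pd i ψt) x t
          - (I / (hbar : ℂ)) * (V x : ℂ) * ψt x t)
    (φ : (Fin n → ℝ) → ℝ → ℂ)
    (hφx : ∀ t, ContDiff ℝ 2 (fun x => φ x t))
    (hφtime : ∀ x, ContDiff ℝ 1 (fun t => φ x t))
    (hexp : ∀ x t, Complex.exp (φ x t) = ψt x t / ψ x t) :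
    ∀ x t, deriv (fun s => φ x s) t
        + ∑ i, ((hbar : ℂ) / (I * (m : ℂ))) * (pd i ψ x t / ψ x t) * pd i φ x t
        - (I * (hbar : ℂ) / (2 * (m : ℂ))) * ∑ i, pd i (pd i φ) x t
        = (I * (hbar : ℂ) / (2 * (m : ℂ))) * ∑ i, (pd i φ x t) ^ 2 := by
  intro x t
  have hprod : ψt = fun y s => ψ y s * exp (φ y s) := by
    funext y s
    rw [hexp, mul_div_cancel₀ _ (hψ0 y s)]
  have hlap : ∑ i, pd i (pd i ψt) x t
      = (∑ i, pd i (pd i ψ) x t + 2 * ∑ i, pd i ψ x t * pd i φ x t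
          + ψ x t * (∑ i, pd i (pd i φ) x t + ∑ i, pd i φ x t ^ 2)) * exp (φ x t) := by
    simp_rw [hprod, pd_pd_mul_cexp _ hψx hφx, ← Finset.sum_mul, Finset.sum_add_distrib,
      ← Finset.mul_sum, Finset.sum_add_distrib]
  have htime : deriv (fun s => ψt x s) t
      = (deriv (fun s => ψ x s) t + ψ x t * deriv (fun s => φ x s) t) * exp (φ x t) := by
    have hψd := ((hψtime x).differentiable one_ne_zero t).hasDerivAt
    have hφd := ((hφtime x).differentiable one_ne_zero t).hasDerivAt
    rw [hprod, (hψd.fun_mul hφd.cexp).deriv]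
    ring
  have hdrift : ∑ i, ((hbar : ℂ) / (I * (m : ℂ))) * (pd i ψ x t / ψ x t) * pd i φ x t
      = -(I * (hbar : ℂ) / (2 * (m : ℂ))) * (2 * ∑ i, pd i ψ x t * pd i φ x t) / ψ x t := by
    have hm0 : (m : ℂ) ≠ 0 := by exact_mod_cast hm.ne'
    have hc : (hbar : ℂ) / (I * (m : ℂ)) = -(I * (hbar : ℂ) / (2 * (m : ℂ))) * 2 := by
      field_simp
      simp
    rw [hc, ← mul_assoc, Finset.mul_sum, Finset.sum_div]
    exact Finset.sum_congr rfl fun i _ => by ring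
  have key : deriv (fun s => ψ x s) t + ψ x t * deriv (fun s => φ x s) t
      = (I * (hbar : ℂ) / (2 * (m : ℂ))) * (∑ i, pd i (pd i ψ) x t
          + 2 * ∑ i, pd i ψ x t * pd i φ x t
          + ψ x t * (∑ i, pd i (pd i φ) x t + ∑ i, pd i φ x t ^ 2))
        - (I / (hbar : ℂ)) * (V x : ℂ) * ψ x t := by
    apply mul_right_cancel₀ (exp_ne_zero (φ x t))
    rw [← htime, hSEt x t, hlap, congr_fun₂ hprod x t]
    ring
  rw [hSE x t] at key
  rw [hdrift]
  apply mul_left_cancel₀ (hψ0 x t)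
  generalize I * (hbar : ℂ) / (2 * (m : ℂ)) = c at key ⊢
  rw [mul_sub, mul_add, mul_div_cancel₀ _ (hψ0 x t)]
  linear_combination key
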